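/- arXiv:2501.06302 — 3 statements merged into one kernel-verified Lean document; each statement's English description precedes it below -/
import Mathlib

section
/- For all finite sets J, J' of positive integers, the identity D(c_J)·D(c_{J'}) = d(c_J)·d(c_{J'}) + θ · P_{J∩J'} · D(c_{Δ(J,J')}) holds in R (J and J' may be empty, with c_∅ = 1 and D(c_∅) = θ). -/
open MvPolynomial

/-- Variables of the polynomial ring `R = 𝔽₂[θ, a₁, b₁, a₂, b₂, …]`:
`θ` models the class of the square-root line bundle `Θ`, `a k` models the
mod-2 Chern class `c̄_{2k}` and `b k` models `c̄_{2k+1}`. -/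
inductive MVar : Type
  | theta : MVar
  | a : ℕ+ → MVar
  | b : ℕ+ → MVar

/-- The class `θ`. -/
noncomputable def θp : MvPolynomial MVar (ZMod 2) := X MVar.theta

/-- `c_J = ∏_{k ∈ J} aₖ`, modelling the product of even Chern classes `c̄_{2k}`. -/
noncomputable def cP (J : Finset ℕ+) : MvPolynomial MVar (ZMod 2) :=
  ∏ k ∈ J, X (MVar.a k)

/-- `P_J = ∏_{k ∈ J} aₖ²`, modelling the product of Pontryagin-class reductions. -/
noncomputable def PP (J : Finset ℕ+) : MvPolynomial MVar (ZMod 2) :=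
  ∏ k ∈ J, (X (MVar.a k)) ^ 2

/-- The twisted operation `D(p) = d(p) + θ·p`, modelling `Sq²_Θ`. -/
noncomputable def Dop
    (d : Derivation (ZMod 2) (MvPolynomial MVar (ZMod 2)) (MvPolynomial MVar (ZMod 2)))
    (p : MvPolynomial MVar (ZMod 2)) : MvPolynomial MVar (ZMod 2) :=
  d p + θp * p

theorem PP_eq_cP_sq (J : Finset ℕ+) : PP J = cP J ^ 2 :=
  Finset.prod_pow J 2 _

theorem cP_mul_cP (J J' : Finset ℕ+) :
    cP J * cP J' = PP (J ∩ J') * cP (symmDiff J J') := by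
  have hd : cP (symmDiff J J') = cP (J \ J') * cP (J' \ J) :=
    Finset.prod_union disjoint_sdiff_sdiff
  have hJ : cP (J ∩ J') * cP (J \ J') = cP J := Finset.prod_inter_mul_prod_sdiff J J' _
  have hJ' : cP (J ∩ J') * cP (J' \ J) = cP J' := by
    rw [Finset.inter_comm]
    exact Finset.prod_inter_mul_prod_sdiff J' J _
  rw [hd, PP_eq_cP_sq, ← hJ, ← hJ']
  ring

theorem derivation_sq_eq_zero {A : Type*} [CommRing A] [Algebra (ZMod 2) A] [CharP A 2]
    (d : Derivation (ZMod 2) A A) (x : A) : d (x ^ 2) = 0 := by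
  rw [pow_two, d.leibniz, CharTwo.add_self_eq_zero]

/-- The multiplication formula for twisted Bockstein classes, reduced mod 2:
`D(c_J)·D(c_{J'}) = d(c_J)·d(c_{J'}) + θ · P_{J∩J'} · D(c_{Δ(J,J')})`,
where `d` is the 𝔽₂-derivation with `d θ = θ²`, `d aₖ = bₖ`, `d bₖ = 0`
(modelling `Sq²`) and `D p = d p + θ·p` (modelling `Sq²_Θ`). Here `J, J'` are
finite sets of positive integers, possibly empty, with `c_∅ = 1` and `D(c_∅) = θ`. -/
theorem bockstein_product_twisted
    (d : Derivation (ZMod 2) (MvPolynomial MVar (ZMod 2)) (MvPolynomial MVar (ZMod 2)))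
    (hθ : d θp = θp ^ 2)
    (ha : ∀ k : ℕ+, d (X (MVar.a k)) = X (MVar.b k))
    (hb : ∀ k : ℕ+, d (X (MVar.b k)) = 0)
    (J J' : Finset ℕ+) :
    Dop d (cP J) * Dop d (cP J') =
      d (cP J) * d (cP J') + θp * PP (J ∩ J') * Dop d (cP (symmDiff J J')) := by
  have hP : d (PP (J ∩ J')) = 0 := by
    rw [PP_eq_cP_sq, derivation_sq_eq_zero]
  have hc := cP_mul_cP J J'
  have hd := congrArg d hc
  simp only [Derivation.leibniz, smul_eq_mul, hP, mul_zero, add_zero] at hd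
  unfold Dop
  linear_combination θp * hd + θp ^ 2 * hc
end

section
/- The kernel of the composite ∂ = d∘π : R_ℤ → R equals the subring of R_ℤ generated by the set {θ²} ∪ {x_{2i+1} : 3 ≤ 2i+1 ≤ n} ∪ {x_{2i}² : 2 ≤ 2i ≤ n} ∪ {xₙ} ∪ {S(e,J) : e ∈ {0,1}, J ⊆ {1,…,⌊(n−1)/2⌋}} ∪ {2·θᵉ·∏_{j∈J} x_{2j} : e ∈ {0,1}, J ⊆ {1,…,⌊(n−1)/2⌋}} (note that 2 = 2·θ⁰·c_∅ and 2θ, the image of c₁, are among the last family of generators). -/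
open MvPolynomial

/-- The variable `x_i` (for `2 ≤ i ≤ n`) of `R = 𝔽₂[θ, x₂, …, xₙ]`. -/
noncomputable def xv (n i : ℕ) : MvPolynomial (Option (Fin (n - 1))) (ZMod 2) :=
  if h : 2 ≤ i ∧ i ≤ n then X (some ⟨i - 2, by omega⟩) else 0

/-- The class `θ` in `R = 𝔽₂[θ, x₂, …, xₙ]`. -/
noncomputable def θv (n : ℕ) : MvPolynomial (Option (Fin (n - 1))) (ZMod 2) := X none

/-- The variable `x_i` (for `2 ≤ i ≤ n`) of the integral ring `R_ℤ = ℤ[θ, x₂, …, xₙ]`. -/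
noncomputable def xz (n i : ℕ) : MvPolynomial (Option (Fin (n - 1))) ℤ :=
  if h : 2 ≤ i ∧ i ≤ n then X (some ⟨i - 2, by omega⟩) else 0

/-- The class `θ` in `R_ℤ = ℤ[θ, x₂, …, xₙ]`. -/
noncomputable def θz (n : ℕ) : MvPolynomial (Option (Fin (n - 1))) ℤ := X none

/-- The canonical integral lifts `S(e, J)` of `d(θᵉ·∏_{j∈J} x_{2j})`:
`S(0,J) = Σ_{k∈J} x_{2k+1}·∏_{j∈J∖{k}} x_{2j}` and
`S(1,J) = θ²·∏_{j∈J} x_{2j} + θ·S(0,J)`. -/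
noncomputable def Sgen (n e : ℕ) (J : Finset ℕ) :
    MvPolynomial (Option (Fin (n - 1))) ℤ :=
  if e = 0 then
    ∑ k ∈ J, xz n (2 * k + 1) * ∏ j ∈ J.erase k, xz n (2 * j)
  else
    θz n ^ 2 * ∏ j ∈ J, xz n (2 * j) +
      θz n * ∑ k ∈ J, xz n (2 * k + 1) * ∏ j ∈ J.erase k, xz n (2 * j)


section Homotopy

variable {σ : Type*}

/-- The candidate contracting homotopy in the direction of a variable `y` with `d y = X ^ ζ`: it
sends a monomial with even `y`-exponent divisible by `X ^ ζ` to its multiple by `y / X ^ ζ`. -/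
noncomputable def divHomotopy (y : σ) (ζ : σ →₀ ℕ) :
    MvPolynomial σ (ZMod 2) →ₗ[ZMod 2] MvPolynomial σ (ZMod 2) :=
  open Classical in
  (basisMonomials σ (ZMod 2)).constr (ZMod 2) fun s =>
    if Even (s y) ∧ ζ ≤ s then monomial (s - ζ + Finsupp.single y 1) 1 else 0

/-- The projection onto the monomials with even `y`-exponent not divisible by `X ^ ζ`. -/
noncomputable def residueProj (y : σ) (ζ : σ →₀ ℕ) :
    MvPolynomial σ (ZMod 2) →ₗ[ZMod 2] MvPolynomial σ (ZMod 2) :=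
  open Classical in
  (basisMonomials σ (ZMod 2)).constr (ZMod 2) fun s =>
    if Even (s y) ∧ ¬ ζ ≤ s then monomial s 1 else 0

open Classical in
theorem divHomotopy_monomial (y : σ) (ζ s : σ →₀ ℕ) :
    divHomotopy y ζ (monomial s 1) =
      if Even (s y) ∧ ζ ≤ s then monomial (s - ζ + Finsupp.single y 1) 1 else 0 := by
  have := (basisMonomials σ (ZMod 2)).constr_basis (ZMod 2) (fun s =>
    if Even (s y) ∧ ζ ≤ s then monomial (s - ζ + Finsupp.single y 1) (1 : ZMod 2) else 0) s
  rwa [coe_basisMonomials] at this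

open Classical in
theorem residueProj_monomial (y : σ) (ζ s : σ →₀ ℕ) :
    residueProj y ζ (monomial s 1) =
      if Even (s y) ∧ ¬ ζ ≤ s then monomial s 1 else 0 := by
  have := (basisMonomials σ (ZMod 2)).constr_basis (ZMod 2) (fun s =>
    if Even (s y) ∧ ¬ ζ ≤ s then monomial s (1 : ZMod 2) else 0) s
  rwa [coe_basisMonomials] at this

theorem le_add_iff_of_disjoint {ζ u s : σ →₀ ℕ} (h : Disjoint u.support ζ.support) :
    ζ ≤ u + s ↔ ζ ≤ s := by
  refine ⟨fun H w => ?_, fun H => H.trans le_add_self⟩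
  by_cases hw : ζ w = 0
  · simp [hw]
  · have h0 : u w = 0 := by
      by_contra hu
      exact Finset.disjoint_left.1 h (Finsupp.mem_support_iff.2 hu) (Finsupp.mem_support_iff.2 hw)
    simpa [h0] using H w

theorem divHomotopy_monomial_mul {y : σ} {ζ u : σ →₀ ℕ} (hy : u y = 0)
    (h : Disjoint u.support ζ.support) (p : MvPolynomial σ (ZMod 2)) :
    divHomotopy y ζ (monomial u 1 * p) = monomial u 1 * divHomotopy y ζ p := by
  suffices H : divHomotopy y ζ ∘ₗ LinearMap.mulLeft (ZMod 2) (monomial u 1) =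
      LinearMap.mulLeft (ZMod 2) (monomial u 1) ∘ₗ divHomotopy y ζ from
    LinearMap.congr_fun H p
  refine (basisMonomials σ (ZMod 2)).ext fun s => ?_
  simp only [coe_basisMonomials, LinearMap.comp_apply, LinearMap.mulLeft_apply, monomial_mul,
    mul_one, divHomotopy_monomial, le_add_iff_of_disjoint h, Finsupp.add_apply, hy, zero_add]
  split_ifs with hs
  · rw [monomial_mul, mul_one, add_tsub_assoc_of_le hs.2, add_assoc]
  · simp

theorem residueProj_monomial_mul {y : σ} {ζ u : σ →₀ ℕ} (hy : u y = 0)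
    (h : Disjoint u.support ζ.support) (p : MvPolynomial σ (ZMod 2)) :
    residueProj y ζ (monomial u 1 * p) = monomial u 1 * residueProj y ζ p := by
  suffices H : residueProj y ζ ∘ₗ LinearMap.mulLeft (ZMod 2) (monomial u 1) =
      LinearMap.mulLeft (ZMod 2) (monomial u 1) ∘ₗ residueProj y ζ from
    LinearMap.congr_fun H p
  refine (basisMonomials σ (ZMod 2)).ext fun s => ?_
  simp only [coe_basisMonomials, LinearMap.comp_apply, LinearMap.mulLeft_apply, monomial_mul,
    mul_one, residueProj_monomial, le_add_iff_of_disjoint h, Finsupp.add_apply, hy, zero_add]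
  split_ifs <;> simp [monomial_mul]

variable (d : Derivation (ZMod 2) (MvPolynomial σ (ZMod 2)) (MvPolynomial σ (ZMod 2)))

/-- The pair `(y, ζ)` splits off from `d`: `d y = X ^ ζ`, the other variables of `X ^ ζ` are
cycles, and `d` maps every remaining variable to zero or a monomial in remaining variables. -/
structure SplitsOff (y : σ) (ζ : σ →₀ ℕ) : Prop where
  even_apply : Even (ζ y)
  map_X_self : d (X y) = monomial ζ 1
  map_X_of_mem : ∀ w, w ≠ y → ζ w ≠ 0 → d (X w) = 0
  map_X_of_notMem : ∀ w, w ≠ y → ζ w = 0 → d (X w) = 0 ∨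
    ∃ u : σ →₀ ℕ, d (X w) = monomial u 1 ∧ u y = 0 ∧ Disjoint u.support ζ.support

variable {d}

theorem derivation_sq_eq_zero_s9 (p : MvPolynomial σ (ZMod 2)) : d (p ^ 2) = 0 := by
  rw [pow_two, Derivation.leibniz, CharTwo.add_self_eq_zero]

theorem derivation_monomial_eq_zero {y : σ} {s : σ →₀ ℕ} (hs : Even (s y))
    (h : ∀ w, w ≠ y → s w ≠ 0 → d (X w) = 0) : d (monomial s 1) = 0 := by
  obtain ⟨k, hk⟩ := hs
  have h1 : monomial s (1 : ZMod 2) = (X y ^ k) ^ 2 * monomial (s.erase y) 1 := by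
    rw [← pow_mul, X_pow_eq_monomial, monomial_mul, mul_one, mul_two, ← hk,
      Finsupp.single_add_erase]
  have h2 : d (monomial (s.erase y) 1) = 0 := by
    classical
    refine derivation_eq_zero_of_forall_mem_vars fun w hw => ?_
    rw [vars_monomial one_ne_zero, Finsupp.support_erase, Finset.mem_erase,
      Finsupp.mem_support_iff] at hw
    exact h w hw.1 hw.2
  rw [h1, Derivation.leibniz, h2, derivation_sq_eq_zero_s9, smul_zero, smul_zero, add_zero]

theorem SplitsOff.homotopy_monomial {y : σ} {ζ : σ →₀ ℕ} (H : SplitsOff d y ζ) {s : σ →₀ ℕ}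
    (hs : ∀ w, w ≠ y → ζ w = 0 → s w = 0) :
    d (divHomotopy y ζ (monomial s 1)) + divHomotopy y ζ (d (monomial s 1)) +
      residueProj y ζ (monomial s 1) = monomial s 1 := by
  have key : ∀ t : σ →₀ ℕ, Even (t y) → (∀ w, w ≠ y → ζ w = 0 → t w = 0) →
      d (monomial t 1) = 0 := fun t ht h =>
    derivation_monomial_eq_zero ht fun w hw hw' =>
      H.map_X_of_mem w hw fun h0 => hw' (h w hw h0)
  have step : ∀ t : σ →₀ ℕ, Even (t y) → (∀ w, w ≠ y → ζ w = 0 → t w = 0) →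
      d (monomial (t + Finsupp.single y 1) 1) = monomial (t + ζ) 1 := fun t ht h => by
    rw [monomial_add_single, pow_one, Derivation.leibniz, key t ht h, H.map_X_self, smul_zero,
      add_zero, smul_eq_mul, monomial_mul, mul_one]
  rcases Nat.even_or_odd (s y) with he | ho
  · rw [key s he hs, map_zero, add_zero, divHomotopy_monomial, residueProj_monomial]
    by_cases hle : ζ ≤ s
    · rw [if_pos ⟨he, hle⟩, if_neg (by tauto), add_zero, step, tsub_add_cancel_of_le hle]
      · rw [Finsupp.tsub_apply, Nat.even_sub (hle y)]
        exact iff_of_true he H.even_apply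
      · intro w hw h0
        simp [hs w hw h0]
    · rw [if_neg (by tauto), if_pos ⟨he, hle⟩, map_zero, zero_add]
  · obtain ⟨t, rfl⟩ : ∃ t, s = t + Finsupp.single y 1 :=
      ⟨s - Finsupp.single y 1, (tsub_add_cancel_of_le (by
        rw [Finsupp.single_le_iff]; exact ho.pos)).symm⟩
    have ht : Even (t y) := by
      simpa [Nat.odd_add_one] using ho
    have hne : ¬ Even ((t + Finsupp.single y 1 : σ →₀ ℕ) y) := Nat.not_even_iff_odd.2 ho
    rw [step t ht, divHomotopy_monomial, divHomotopy_monomial, residueProj_monomial,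
      if_neg fun h => hne h.1, if_pos, if_neg fun h => hne h.1, map_zero, zero_add, add_zero,
      add_tsub_cancel_right]
    · exact ⟨by simpa using ht.add H.even_apply, le_add_self⟩
    · intro w hw h0
      have := hs w hw h0
      rw [Finsupp.add_apply] at this
      omega

theorem SplitsOff.homotopy_X_mul {y : σ} {ζ : σ →₀ ℕ} (H : SplitsOff d y ζ) {w : σ}
    (hw : w ≠ y) (hζ : ζ w = 0) {p : MvPolynomial σ (ZMod 2)}
    (hp : d (divHomotopy y ζ p) + divHomotopy y ζ (d p) + residueProj y ζ p = p) :
    d (divHomotopy y ζ (X w * p)) + divHomotopy y ζ (d (X w * p)) + residueProj y ζ (X w * p) =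
      X w * p := by
  have hu : (Finsupp.single w 1 : σ →₀ ℕ) y = 0 := Finsupp.single_eq_of_ne hw.symm
  have hd : Disjoint (Finsupp.single w 1 : σ →₀ ℕ).support ζ.support := by
    refine Finset.disjoint_left.2 fun v hv => ?_
    rw [Finset.mem_singleton.1 (Finsupp.support_single_subset hv), Finsupp.notMem_support_iff]
    exact hζ
  have hX : ∀ q, divHomotopy y ζ (X w * q) = X w * divHomotopy y ζ q :=
    divHomotopy_monomial_mul hu hd
  have hX' : residueProj y ζ (X w * p) = X w * residueProj y ζ p :=
    residueProj_monomial_mul hu hd p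
  have hdX : divHomotopy y ζ (d (X w) * p) = d (X w) * divHomotopy y ζ p := by
    rcases H.map_X_of_notMem w hw hζ with h0 | ⟨u, h1, h2, h3⟩
    · simp [h0]
    · rw [h1, divHomotopy_monomial_mul h2 h3]
  rw [hX, hX', Derivation.leibniz, Derivation.leibniz, map_add]
  simp only [smul_eq_mul]
  rw [hX, mul_comm p, hdX, mul_comm (divHomotopy y ζ p)]
  linear_combination X w * hp + CharTwo.add_self_eq_zero (d (X w) * divHomotopy y ζ p)

theorem SplitsOff.homotopy {y : σ} {ζ : σ →₀ ℕ} (H : SplitsOff d y ζ)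
    (p : MvPolynomial σ (ZMod 2)) :
    d (divHomotopy y ζ p) + divHomotopy y ζ (d p) + residueProj y ζ p = p := by
  suffices h : d.toLinearMap ∘ₗ divHomotopy y ζ + divHomotopy y ζ ∘ₗ d.toLinearMap +
      residueProj y ζ = LinearMap.id from LinearMap.congr_fun h p
  refine (basisMonomials σ (ZMod 2)).ext fun s => ?_
  rw [coe_basisMonomials]
  change d (divHomotopy y ζ (monomial s 1)) + divHomotopy y ζ (d (monomial s 1)) +
    residueProj y ζ (monomial s 1) = monomial s 1
  induction hk : s.degree generalizing s with
  | zero =>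
    rw [Finsupp.degree_eq_zero_iff] at hk
    exact H.homotopy_monomial (by simp [hk])
  | succ k ih =>
    by_cases hs : ∀ w, w ≠ y → ζ w = 0 → s w = 0
    · exact H.homotopy_monomial hs
    · push Not at hs
      obtain ⟨w, hw, hζ, hsw⟩ := hs
      obtain ⟨t, rfl⟩ : ∃ t, s = Finsupp.single w 1 + t :=
        ⟨s - Finsupp.single w 1, (add_tsub_cancel_of_le (by
          rw [Finsupp.single_le_iff]; omega)).symm⟩
      have hX : monomial (Finsupp.single w 1 + t) (1 : ZMod 2) = X w * monomial t 1 := by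
        rw [X, monomial_mul, mul_one]
      rw [hX]
      refine H.homotopy_X_mul hw hζ (ih t ?_)
      rw [map_add, Finsupp.degree_single] at hk
      omega

/-- The span of the monomials with even exponent at each variable in `I`. -/
noncomputable def evenSpan (I : Finset σ) : Submodule (ZMod 2) (MvPolynomial σ (ZMod 2)) :=
  Submodule.span (ZMod 2) ((fun s => monomial s 1) '' {s : σ →₀ ℕ | ∀ y ∈ I, Even (s y)})

theorem residueProj_mem_evenSpan [DecidableEq σ] {I : Finset σ} (y : σ) (ζ : σ →₀ ℕ)
    {p : MvPolynomial σ (ZMod 2)}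
    (hp : p ∈ evenSpan I) : residueProj y ζ p ∈ evenSpan (insert y I) := by
  induction hp using Submodule.span_induction with
  | mem x hx =>
    obtain ⟨s, hs, rfl⟩ := hx
    dsimp only
    rw [residueProj_monomial]
    split_ifs with h
    · refine Submodule.subset_span ⟨s, fun w hw => ?_, rfl⟩
      rcases Finset.mem_insert.1 hw with rfl | hw
      · exact h.1
      · exact hs w hw
    · exact zero_mem _
  | zero => rw [map_zero]; exact zero_mem _
  | add x y _ _ hx hy => rw [map_add]; exact add_mem hx hy
  | smul a x _ hx => rw [map_smul]; exact Submodule.smul_mem _ _ hx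

/-- Cycles are boundaries up to monomials with even exponents at the split-off variables. -/
theorem exists_eq_derivation_add_of_splitsOff (hdd : ∀ p, d (d p) = 0) {I : Finset σ}
    (hI : ∀ y ∈ I, ∃ ζ, SplitsOff d y ζ) {p : MvPolynomial σ (ZMod 2)} (hp : d p = 0) :
    ∃ q, ∃ r ∈ evenSpan I, p = d q + r := by
  classical
  induction I using Finset.induction_on with
  | empty =>
    refine ⟨0, p, ?_, by simp⟩
    have : evenSpan (∅ : Finset σ) = ⊤ := by
      have h := (basisMonomials σ (ZMod 2)).span_eq
      rw [coe_basisMonomials] at h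
      rw [← h, evenSpan]
      congr 1
      ext; simp
    rw [this]; trivial
  | insert y I _ ih =>
    obtain ⟨q, r, hr, hpr⟩ := ih fun y hy => hI y (Finset.mem_insert_of_mem hy)
    obtain ⟨ζ, H⟩ := hI y (Finset.mem_insert_self _ _)
    refine ⟨q + divHomotopy y ζ r, residueProj y ζ r, residueProj_mem_evenSpan y ζ hr, ?_⟩
    have hdr : d r = 0 := by
      have := congrArg d hpr
      rwa [hp, map_add, hdd, zero_add, eq_comm] at this
    have := H.homotopy r
    rw [hdr, map_zero, add_zero] at this
    rw [map_add, add_assoc, this, hpr]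

end Homotopy

section Generators

variable {n : ℕ}

theorem xz_eq_X (k : Fin (n - 1)) : xz n (k + 2) = X (some k) := by
  have := k.2
  rw [xz, dif_pos ⟨by omega, by omega⟩]
  simp

theorem xv_eq_X (k : Fin (n - 1)) : xv n (k + 2) = X (some k) := by
  have := k.2
  rw [xv, dif_pos ⟨by omega, by omega⟩]
  simp

theorem map_xz (i : ℕ) : map (Int.castRingHom (ZMod 2)) (xz n i) = xv n i := by
  unfold xz xv
  split_ifs <;> simp

theorem map_θz : map (Int.castRingHom (ZMod 2)) (θz n) = θv n := by
  simp [θz, θv]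

/-- The subring of `R_ℤ` generated by `θ²`, the odd variables, the squares of the even variables
and the top variable. -/
noncomputable def coeffSubring (n : ℕ) : Subring (MvPolynomial (Option (Fin (n - 1))) ℤ) :=
  Subring.closure
    ({θz n ^ 2}
      ∪ {p | ∃ i : ℕ, 3 ≤ 2 * i + 1 ∧ 2 * i + 1 ≤ n ∧ p = xz n (2 * i + 1)}
      ∪ {p | ∃ i : ℕ, 2 ≤ 2 * i ∧ 2 * i ≤ n ∧ p = xz n (2 * i) ^ 2}
      ∪ {xz n n})

theorem θz_sq_mem : θz n ^ 2 ∈ coeffSubring n :=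
  Subring.subset_closure (Or.inl (Or.inl (Or.inl rfl)))

theorem xz_odd_mem {i : ℕ} (h : 3 ≤ 2 * i + 1) (h' : 2 * i + 1 ≤ n) :
    xz n (2 * i + 1) ∈ coeffSubring n :=
  Subring.subset_closure (Or.inl (Or.inl (Or.inr ⟨i, h, h', rfl⟩)))

theorem xz_even_sq_mem {i : ℕ} (h : 2 ≤ 2 * i) (h' : 2 * i ≤ n) :
    xz n (2 * i) ^ 2 ∈ coeffSubring n :=
  Subring.subset_closure (Or.inl (Or.inr ⟨i, h, h', rfl⟩))

theorem xz_top_mem : xz n n ∈ coeffSubring n :=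
  Subring.subset_closure (Or.inr rfl)

/-- Every variable `x_i` is `x_{2j}` with `2j < n` or lies in the coefficient subring. -/
theorem X_some_mem_or (k : Fin (n - 1)) :
    (∃ j ∈ Finset.Icc 1 ((n - 1) / 2), (k : ℕ) + 2 = 2 * j) ∨
      (X (some k) : MvPolynomial (Option (Fin (n - 1))) ℤ) ∈ coeffSubring n := by
  have hk := k.2
  rcases Nat.even_or_odd' (k + 2) with ⟨j, hj | hj⟩
  · by_cases hjn : 2 * j = n
    · right
      rw [← xz_eq_X, hj, hjn]
      exact xz_top_mem
    · left
      exact ⟨j, Finset.mem_Icc.2 ⟨by omega, by omega⟩, hj⟩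
  · right
    rw [← xz_eq_X, hj]
    exact xz_odd_mem (by omega) (by omega)

/-- The monomials `θᵉ·∏_{j∈J} x_{2j}` span `R_ℤ` over the coefficient subring. -/
theorem span_squarefree_eq_top :
    Submodule.span (coeffSubring n)
      {p | ∃ e ≤ 1, ∃ J ⊆ Finset.Icc 1 ((n - 1) / 2),
        p = θz n ^ e * ∏ j ∈ J, xz n (2 * j)} = ⊤ := by
  set N := Submodule.span (coeffSubring n)
      {p | ∃ e ≤ 1, ∃ J ⊆ Finset.Icc 1 ((n - 1) / 2),
        p = θz n ^ e * ∏ j ∈ J, xz n (2 * j)}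
  have hgen : ∀ e ≤ 1, ∀ J ⊆ Finset.Icc 1 ((n - 1) / 2),
      θz n ^ e * ∏ j ∈ J, xz n (2 * j) ∈ N := fun e he J hJ =>
    Submodule.subset_span ⟨e, he, J, hJ, rfl⟩
  have hsmul : ∀ a ∈ coeffSubring n, ∀ p ∈ N, a * p ∈ N := fun a ha p hp =>
    N.smul_mem ⟨a, ha⟩ hp
  have hone : (1 : MvPolynomial (Option (Fin (n - 1))) ℤ) ∈ N := by
    simpa using hgen 0 zero_le_one ∅ (Finset.empty_subset _)
  have hX : ∀ w, ∀ p ∈ N, X w * p ∈ N := by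
    intro w p hp
    induction hp using Submodule.span_induction with
    | mem x hx =>
      obtain ⟨e, he, J, hJ, rfl⟩ := hx
      rcases w with _ | k
      · change θz n * _ ∈ N
        rw [← mul_assoc, ← pow_succ']
        rcases Nat.le_one_iff_eq_zero_or_eq_one.1 he with rfl | rfl
        · exact hgen 1 le_rfl J hJ
        · refine hsmul _ θz_sq_mem _ ?_
          simpa using hgen 0 zero_le_one J hJ
      · rcases X_some_mem_or k with ⟨i, hi, hki⟩ | h
        · rw [← xz_eq_X, hki, mul_left_comm]
          by_cases hiJ : i ∈ J
          · rw [← Finset.mul_prod_erase _ _ hiJ, ← mul_assoc (xz n (2 * i)), ← pow_two,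
              mul_left_comm]
            rw [Finset.mem_Icc] at hi
            exact hsmul _ (xz_even_sq_mem (by omega) (by omega)) _
              (hgen e he _ ((Finset.erase_subset _ _).trans hJ))
          · rw [← Finset.prod_insert (f := fun j => xz n (2 * j)) hiJ]
            exact hgen e he _ (Finset.insert_subset hi hJ)
        · exact hsmul _ h _ (Submodule.subset_span ⟨e, he, J, hJ, rfl⟩)
    | zero => rw [mul_zero]; exact N.zero_mem
    | add x y _ _ hx hy => rw [mul_add]; exact N.add_mem hx hy
    | smul a x _ hx => rw [mul_smul_comm]; exact N.smul_mem a hx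
  refine eq_top_iff.2 fun p _ => ?_
  induction p using MvPolynomial.induction_on with
  | C a =>
    have : (C a : MvPolynomial (Option (Fin (n - 1))) ℤ) = (a : MvPolynomial _ ℤ) * 1 := by
      simp
    rw [this]
    exact hsmul _ (intCast_mem _ a) _ hone
  | add p q hp hq => exact N.add_mem (hp trivial) (hq trivial)
  | mul_X p w hp => rw [mul_comm]; exact hX w p (hp trivial)

theorem derivation_prod {ι R A : Type*} [DecidableEq ι] [CommSemiring R] [CommSemiring A]
    [Algebra R A] (d : Derivation R A A) (f : ι → A) (J : Finset ι) :
    d (∏ j ∈ J, f j) = ∑ k ∈ J, d (f k) * ∏ j ∈ J.erase k, f j := by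
  induction J using Finset.induction_on with
  | empty => simp
  | insert i J hi ih =>
    rw [Finset.prod_insert hi, Derivation.leibniz, ih, Finset.sum_insert hi,
      Finset.erase_insert hi, smul_eq_mul, smul_eq_mul, add_comm, mul_comm (d (f i)),
      Finset.mul_sum, mul_comm (∏ j ∈ J, f j)]
    congr 1
    refine Finset.sum_congr rfl fun k hk => ?_
    have hki : k ≠ i := fun h => hi (h ▸ hk)
    rw [Finset.erase_insert_of_ne hki.symm,
      Finset.prod_insert fun h => hi (Finset.mem_of_mem_erase h), mul_left_comm]

end Generators

section Boundary

variable {n : ℕ}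
  {d : Derivation (ZMod 2) (MvPolynomial (Option (Fin (n - 1))) (ZMod 2))
    (MvPolynomial (Option (Fin (n - 1))) (ZMod 2))}

theorem map_Sgen (hθ : d (θv n) = θv n ^ 2)
    (heven : ∀ i : ℕ, 1 ≤ i → 2 * i + 1 ≤ n → d (xv n (2 * i)) = xv n (2 * i + 1))
    {e : ℕ} (he : e ≤ 1) {J : Finset ℕ} (hJ : J ⊆ Finset.Icc 1 ((n - 1) / 2)) :
    map (Int.castRingHom (ZMod 2)) (Sgen n e J) =
      d (map (Int.castRingHom (ZMod 2)) (θz n ^ e * ∏ j ∈ J, xz n (2 * j))) := by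
  have hsum : ∑ k ∈ J, xv n (2 * k + 1) * ∏ j ∈ J.erase k, xv n (2 * j) =
      d (∏ j ∈ J, xv n (2 * j)) := by
    rw [derivation_prod]
    refine Finset.sum_congr rfl fun k hk => ?_
    have := Finset.mem_Icc.1 (hJ hk)
    rw [heven k (by omega) (by omega)]
  rcases Nat.le_one_iff_eq_zero_or_eq_one.1 he with rfl | rfl
  · simp only [Sgen, if_true, map_sum, map_mul, map_prod, map_xz, hsum, pow_zero, one_mul]
  · simp only [Sgen, one_ne_zero, if_false, map_sum, map_add, map_mul, map_pow, map_prod, map_xz,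
      map_θz, hsum, pow_one, Derivation.leibniz, hθ, smul_eq_mul]
    ring

theorem derivation_xv_top (htop : ∀ i : ℕ, 2 * i = n → d (xv n (2 * i)) = 0)
    (hodd : ∀ j : ℕ, Odd j → d (xv n j) = 0) : d (xv n n) = 0 := by
  rcases Nat.even_or_odd' n with ⟨i, hi | hi⟩
  · have := htop i hi.symm
    rwa [← hi] at this
  · exact hodd n ⟨i, hi⟩

theorem derivation_map_of_mem_coeffSubring
    (htop : ∀ i : ℕ, 2 * i = n → d (xv n (2 * i)) = 0)
    (hodd : ∀ j : ℕ, Odd j → d (xv n j) = 0)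
    {a : MvPolynomial (Option (Fin (n - 1))) ℤ} (ha : a ∈ coeffSubring n) :
    d (map (Int.castRingHom (ZMod 2)) a) = 0 := by
  induction ha using Subring.closure_induction with
  | mem x hx =>
    rcases hx with ((rfl | ⟨i, -, -, rfl⟩) | ⟨i, -, -, rfl⟩) | rfl
    · rw [map_pow, derivation_sq_eq_zero_s9]
    · rw [map_xz]
      exact hodd _ ⟨i, rfl⟩
    · rw [map_pow, derivation_sq_eq_zero_s9]
    · rw [map_xz]
      exact derivation_xv_top htop hodd
  | zero => simp
  | one => simp
  | add x y _ _ hx hy => rw [map_add, map_add, hx, hy, add_zero]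
  | neg x _ hx => rw [map_neg, map_neg, hx, neg_zero]
  | mul x y _ _ hx hy => rw [map_mul, Derivation.leibniz, hx, hy, smul_zero, smul_zero, add_zero]

theorem derivation_derivation_eq_zero (hθ : d (θv n) = θv n ^ 2)
    (heven : ∀ i : ℕ, 1 ≤ i → 2 * i + 1 ≤ n → d (xv n (2 * i)) = xv n (2 * i + 1))
    (htop : ∀ i : ℕ, 2 * i = n → d (xv n (2 * i)) = 0)
    (hodd : ∀ j : ℕ, Odd j → d (xv n j) = 0)
    (p : MvPolynomial (Option (Fin (n - 1))) (ZMod 2)) : d (d p) = 0 := by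
  induction p using MvPolynomial.induction_on with
  | C a => simp
  | add p q hp hq => rw [map_add, map_add, hp, hq, add_zero]
  | mul_X p w hp =>
    have hw : d (d (X w)) = 0 := by
      rcases w with _ | k
      · change d (d (θv n)) = 0
        rw [hθ, derivation_sq_eq_zero_s9]
      · have hk := k.2
        rw [← xv_eq_X]
        rcases Nat.even_or_odd' (k + 2) with ⟨j, hj | hj⟩
        · rw [hj]
          by_cases hjn : 2 * j = n
          · rw [htop j hjn, map_zero]
          · rw [heven j (by omega) (by omega)]
            exact hodd _ ⟨j, rfl⟩
        · rw [hodd _ ⟨j, hj⟩, map_zero]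
    simp only [Derivation.leibniz, map_add, hp, hw, smul_eq_mul, mul_zero, zero_add]
    rw [mul_comm, CharTwo.add_self_eq_zero]

theorem derivation_X_odd (hodd : ∀ j : ℕ, Odd j → d (xv n j) = 0) {k : Fin (n - 1)}
    (hk : Odd (k : ℕ)) : d (X (some k)) = 0 := by
  rw [← xv_eq_X]
  exact hodd _ (hk.add_even even_two)

theorem derivation_X_top (htop : ∀ i : ℕ, 2 * i = n → d (xv n (2 * i)) = 0)
    {k : Fin (n - 1)} (hk : Even (k : ℕ)) (hkn : (k : ℕ) + 2 = n) : d (X (some k)) = 0 := by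
  obtain ⟨i, hi⟩ := hk
  rw [← xv_eq_X, show (k : ℕ) + 2 = 2 * (i + 1) by omega]
  exact htop _ (by omega)

theorem derivation_X_even
    (heven : ∀ i : ℕ, 1 ≤ i → 2 * i + 1 ≤ n → d (xv n (2 * i)) = xv n (2 * i + 1))
    {k : Fin (n - 1)} (hk : Even (k : ℕ)) (hkn : (k : ℕ) + 1 < n - 1) :
    d (X (some k)) = monomial (Finsupp.single (some ⟨k + 1, hkn⟩) 1) 1 := by
  obtain ⟨i, hi⟩ := hk
  rw [← xv_eq_X, show (k : ℕ) + 2 = 2 * (i + 1) by omega, heven _ (by omega) (by omega),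
    show 2 * (i + 1) + 1 = (⟨k + 1, hkn⟩ : Fin (n - 1)) + 2 by simp; omega, xv_eq_X, X]

theorem splitsOff_none (hθ : d (θv n) = θv n ^ 2)
    (heven : ∀ i : ℕ, 1 ≤ i → 2 * i + 1 ≤ n → d (xv n (2 * i)) = xv n (2 * i + 1))
    (htop : ∀ i : ℕ, 2 * i = n → d (xv n (2 * i)) = 0)
    (hodd : ∀ j : ℕ, Odd j → d (xv n j) = 0) :
    SplitsOff d none (Finsupp.single none 2) where
  even_apply := by simp
  map_X_self := by rw [← X_pow_eq_monomial]; exact hθ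
  map_X_of_mem w hw h := absurd (Finsupp.single_eq_of_ne hw) h
  map_X_of_notMem w hw _ := by
    rcases w with _ | l
    · exact absurd rfl hw
    · rcases Nat.even_or_odd (l : ℕ) with hl | hl
      · by_cases hln : (l : ℕ) + 1 < n - 1
        · refine Or.inr ⟨_, derivation_X_even heven hl hln, by simp, ?_⟩
          refine Finset.disjoint_of_subset_left Finsupp.support_single_subset
            (Finset.disjoint_of_subset_right Finsupp.support_single_subset ?_)
          simp
        · exact Or.inl (derivation_X_top htop hl (by have := l.2; omega))
      · exact Or.inl (derivation_X_odd hodd hl)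

theorem splitsOff_some (hθ : d (θv n) = θv n ^ 2)
    (heven : ∀ i : ℕ, 1 ≤ i → 2 * i + 1 ≤ n → d (xv n (2 * i)) = xv n (2 * i + 1))
    (htop : ∀ i : ℕ, 2 * i = n → d (xv n (2 * i)) = 0)
    (hodd : ∀ j : ℕ, Odd j → d (xv n j) = 0)
    {k : Fin (n - 1)} (hk : Even (k : ℕ)) (hkn : (k : ℕ) + 1 < n - 1) :
    SplitsOff d (some k) (Finsupp.single (some ⟨k + 1, hkn⟩) 1) where
  even_apply := by
    rw [Finsupp.single_eq_of_ne]
    · exact Even.zero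
    · simp [Fin.ext_iff]
  map_X_self := derivation_X_even heven hk hkn
  map_X_of_mem w _ h := by
    obtain rfl : w = some ⟨k + 1, hkn⟩ := by
      by_contra hne
      exact h (Finsupp.single_eq_of_ne hne)
    exact derivation_X_odd hodd hk.add_one
  map_X_of_notMem w hw _ := by
    rcases w with _ | l
    · refine Or.inr ⟨Finsupp.single none 2, ?_, by simp, ?_⟩
      · rw [← X_pow_eq_monomial]; exact hθ
      · refine Finset.disjoint_of_subset_left Finsupp.support_single_subset
          (Finset.disjoint_of_subset_right Finsupp.support_single_subset ?_)
        simp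
    · rcases Nat.even_or_odd (l : ℕ) with hl | hl
      · by_cases hln : (l : ℕ) + 1 < n - 1
        · refine Or.inr ⟨_, derivation_X_even heven hl hln, ?_, ?_⟩
          · refine Finsupp.single_eq_of_ne fun h => ?_
            rw [Option.some_inj, Fin.ext_iff] at h
            dsimp only at h
            rw [h, Nat.even_add_one] at hk
            exact hk hl
          · refine Finset.disjoint_of_subset_left Finsupp.support_single_subset
              (Finset.disjoint_of_subset_right Finsupp.support_single_subset ?_)
            rw [Finset.disjoint_singleton, Ne, Option.some_inj, Fin.ext_iff]
            dsimp only
            intro h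
            exact hw (congrArg some (Fin.ext (by omega)))
        · exact Or.inl (derivation_X_top htop hl (by have := l.2; omega))
      · exact Or.inl (derivation_X_odd hodd hl)

/-- The variables `θ` and `x_{2i}` with `2i < n`. -/
noncomputable def cellVars (n : ℕ) : Finset (Option (Fin (n - 1))) :=
  insert none ((Finset.univ.filter fun k : Fin (n - 1) =>
    Even (k : ℕ) ∧ (k : ℕ) + 1 < n - 1).map Function.Embedding.some)

theorem exists_splitsOff (hθ : d (θv n) = θv n ^ 2)
    (heven : ∀ i : ℕ, 1 ≤ i → 2 * i + 1 ≤ n → d (xv n (2 * i)) = xv n (2 * i + 1))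
    (htop : ∀ i : ℕ, 2 * i = n → d (xv n (2 * i)) = 0)
    (hodd : ∀ j : ℕ, Odd j → d (xv n j) = 0) :
    ∀ y ∈ cellVars n, ∃ ζ, SplitsOff d y ζ := by
  intro y hy
  rcases y with _ | k
  · exact ⟨_, splitsOff_none hθ heven htop hodd⟩
  · obtain ⟨hk, hkn⟩ : Even (k : ℕ) ∧ (k : ℕ) + 1 < n - 1 := by simpa [cellVars] using hy
    exact ⟨_, splitsOff_some hθ heven htop hodd hk hkn⟩

theorem mem_map_coeffSubring_of_mem_evenSpan {r : MvPolynomial (Option (Fin (n - 1))) (ZMod 2)}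
    (hr : r ∈ evenSpan (cellVars n)) :
    r ∈ (coeffSubring n).map (map (Int.castRingHom (ZMod 2))) := by
  induction hr using Submodule.span_induction with
  | mem x hx =>
    obtain ⟨s, hs, rfl⟩ := hx
    dsimp only
    rw [monomial_eq, C_1, one_mul]
    refine Subring.prod_mem _ fun w _ => ?_
    dsimp only
    rcases w with _ | k
    · obtain ⟨m, hm⟩ := hs none (by simp [cellVars])
      rw [hm, ← two_mul, pow_mul]
      exact pow_mem (Subring.mem_map.2 ⟨_, θz_sq_mem, by rw [map_pow, map_θz]; rfl⟩) _
    · rcases X_some_mem_or k with ⟨j, hj, hkj⟩ | h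
      · rw [Finset.mem_Icc] at hj
        obtain ⟨m, hm⟩ := hs (some k) (by
          simp only [cellVars, Finset.mem_insert, Finset.mem_map, Finset.mem_filter,
            Finset.mem_univ, true_and, reduceCtorEq, false_or]
          exact ⟨k, ⟨⟨j - 1, by omega⟩, by omega⟩, rfl⟩)
        rw [hm, ← two_mul, pow_mul]
        refine pow_mem (Subring.mem_map.2 ⟨_, xz_even_sq_mem (i := j) (by omega) (by omega), ?_⟩) _
        rw [map_pow, ← hkj, xz_eq_X, map_X]
      · exact pow_mem (Subring.mem_map.2 ⟨_, h, map_X _ _⟩) _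
  | zero => exact zero_mem _
  | add x y _ _ hx hy => exact add_mem hx hy
  | smul a x _ hx =>
    obtain ⟨m, rfl⟩ := ZMod.intCast_surjective a
    rw [Int.cast_smul_eq_zsmul]
    exact zsmul_mem hx m

end Boundary

/-- The kernel of the composite `∂ = d ∘ π : R_ℤ → R`, where
`π : ℤ[θ, x₂, …, xₙ] → 𝔽₂[θ, x₂, …, xₙ]` is reduction mod 2 fixing the variables
and `d` is the 𝔽₂-derivation with `d θ = θ²`, `d x_{2i} = x_{2i+1}` when
`2i+1 ≤ n`, `d x_{2i} = 0` when `2i = n`, and `d x_j = 0` for odd `j`, equals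
the subring of `R_ℤ` generated by `θ²`, the odd classes `x_{2i+1}`, the squares
`x_{2i}²`, the top class `xₙ`, the canonical lifts `S(e,J)`, and the doubled
monomials `2·θᵉ·∏_{j∈J} x_{2j}` for `e ∈ {0,1}`, `J ⊆ {1, …, ⌊(n−1)/2⌋}`. -/
theorem kernel_boundary_integral (n : ℕ) (hn : 2 ≤ n)
    (d : Derivation (ZMod 2) (MvPolynomial (Option (Fin (n - 1))) (ZMod 2))
      (MvPolynomial (Option (Fin (n - 1))) (ZMod 2)))
    (hθ : d (θv n) = θv n ^ 2)
    (heven : ∀ i : ℕ, 1 ≤ i → 2 * i + 1 ≤ n → d (xv n (2 * i)) = xv n (2 * i + 1))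
    (htop : ∀ i : ℕ, 2 * i = n → d (xv n (2 * i)) = 0)
    (hodd : ∀ j : ℕ, Odd j → d (xv n j) = 0) :
    {p : MvPolynomial (Option (Fin (n - 1))) ℤ |
        d (MvPolynomial.map (Int.castRingHom (ZMod 2)) p) = 0} =
      (Subring.closure
        ({θz n ^ 2}
          ∪ {p | ∃ i : ℕ, 3 ≤ 2 * i + 1 ∧ 2 * i + 1 ≤ n ∧ p = xz n (2 * i + 1)}
          ∪ {p | ∃ i : ℕ, 2 ≤ 2 * i ∧ 2 * i ≤ n ∧ p = xz n (2 * i) ^ 2}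
          ∪ {xz n n}
          ∪ {p | ∃ e ≤ 1, ∃ J ⊆ Finset.Icc 1 ((n - 1) / 2), p = Sgen n e J}
          ∪ {p | ∃ e ≤ 1, ∃ J ⊆ Finset.Icc 1 ((n - 1) / 2),
              p = 2 * θz n ^ e * ∏ j ∈ J, xz n (2 * j)}) :
        Set (MvPolynomial (Option (Fin (n - 1))) ℤ)) := by
  set C := Subring.closure
        ({θz n ^ 2}
          ∪ {p | ∃ i : ℕ, 3 ≤ 2 * i + 1 ∧ 2 * i + 1 ≤ n ∧ p = xz n (2 * i + 1)}
          ∪ {p | ∃ i : ℕ, 2 ≤ 2 * i ∧ 2 * i ≤ n ∧ p = xz n (2 * i) ^ 2}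
          ∪ {xz n n}
          ∪ {p | ∃ e ≤ 1, ∃ J ⊆ Finset.Icc 1 ((n - 1) / 2), p = Sgen n e J}
          ∪ {p | ∃ e ≤ 1, ∃ J ⊆ Finset.Icc 1 ((n - 1) / 2),
              p = 2 * θz n ^ e * ∏ j ∈ J, xz n (2 * j)})
  have hdd := derivation_derivation_eq_zero hθ heven htop hodd
  have hcoeff : coeffSubring n ≤ C := Subring.closure_mono fun p hp => Or.inl (Or.inl hp)
  have hS : ∀ e ≤ 1, ∀ J ⊆ Finset.Icc 1 ((n - 1) / 2), Sgen n e J ∈ C := fun e he J hJ =>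
    Subring.subset_closure (Or.inl (Or.inr ⟨e, he, J, hJ, rfl⟩))
  have hdbl : ∀ p, 2 * p ∈ C := fun p => by
    have hp := (Submodule.eq_top_iff'.1 span_squarefree_eq_top) p
    induction hp using Submodule.span_induction with
    | mem x hx =>
      obtain ⟨e, he, J, hJ, rfl⟩ := hx
      exact Subring.subset_closure (Or.inr ⟨e, he, J, hJ, (mul_assoc _ _ _).symm⟩)
    | zero => rw [mul_zero]; exact zero_mem _
    | add x y _ _ hx hy => rw [mul_add]; exact add_mem hx hy
    | smul a x _ hx => rw [mul_smul_comm]; exact mul_mem (hcoeff a.2) hx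
  have hbdry : ∀ p, d (map (Int.castRingHom (ZMod 2)) p) ∈
      C.map (map (Int.castRingHom (ZMod 2))) := fun p => by
    have hp := (Submodule.eq_top_iff'.1 span_squarefree_eq_top) p
    induction hp using Submodule.span_induction with
    | mem x hx =>
      obtain ⟨e, he, J, hJ, rfl⟩ := hx
      exact ⟨_, hS e he J hJ, map_Sgen hθ heven he hJ⟩
    | zero => rw [map_zero, map_zero]; exact zero_mem _
    | add x y _ _ hx hy => rw [map_add, map_add]; exact add_mem hx hy
    | smul a x _ hx =>
      rw [Subring.smul_def, smul_eq_mul, map_mul, Derivation.leibniz,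
        derivation_map_of_mem_coeffSubring htop hodd a.2, smul_zero, add_zero]
      exact mul_mem ⟨a, hcoeff a.2, rfl⟩ hx
  ext p
  refine ⟨fun hp => ?_, fun hp => ?_⟩
  · obtain ⟨q, r, hr, hpr⟩ := exists_eq_derivation_add_of_splitsOff hdd
      (exists_splitsOff hθ heven htop hodd) hp
    obtain ⟨q, rfl⟩ := map_surjective _ (ZMod.ringHom_surjective (Int.castRingHom (ZMod 2))) q
    obtain ⟨c, hc, hcp⟩ : map (Int.castRingHom (ZMod 2)) p ∈
        C.map (map (Int.castRingHom (ZMod 2))) := by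
      rw [hpr]
      exact add_mem (hbdry q) (Set.image_mono hcoeff (mem_map_coeffSubring_of_mem_evenSpan hr))
    obtain ⟨t, ht⟩ : MvPolynomial.C ((2 : ℕ) : ℤ) ∣ p - c := by
      rw [C_dvd_iff_zmod, map_sub, hcp, sub_self]
    rw [← sub_add_cancel p c, ht]
    refine add_mem ?_ hc
    simpa using hdbl t
  · change p ∈ C at hp
    change d (map (Int.castRingHom (ZMod 2)) p) = 0
    induction hp using Subring.closure_induction with
    | mem x hx =>
      rcases hx with (hx | ⟨e, he, J, hJ, rfl⟩) | ⟨e, he, J, hJ, rfl⟩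
      · exact derivation_map_of_mem_coeffSubring htop hodd (Subring.subset_closure hx)
      · rw [map_Sgen hθ heven he hJ, hdd]
      · rw [mul_assoc, two_mul, map_add, CharTwo.add_self_eq_zero, map_zero]
    | zero => simp
    | one => simp
    | add x y _ _ hx hy => rw [map_add, map_add, hx, hy, add_zero]
    | neg x _ hx => rw [map_neg, map_neg, hx, neg_zero]
    | mul x y _ _ hx hy =>
      rw [map_mul, Derivation.leibniz, hx, hy, smul_zero, smul_zero, add_zero]
end

section
/- For every p ∈ R: (1) d(p) lies in the additive subgroup of R generated by the products k·d(θᵉ·c_J) with k ∈ ker d, e ∈ {0,1} and J ⊆ {1,…,⌊(n−1)/2⌋}; and (2) D(p) lies in the additive subgroup of R generated by the products k·D(c_J) with k ∈ ker d and J ⊆ {1,…,⌊(n−1)/2⌋} (including J = ∅, with D(c_∅) = θ). Equivalently, the image of d is contained in the (ker d)-submodule generated by the elements d(θᵉ·c_J), and the image of D is contained in the (ker d)-submodule generated by the elements D(c_J). -/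
open MvPolynomial

/-- `c_J = ∏_{j ∈ J} x_{2j}`, the product of even Chern classes. -/
noncomputable def cv (n : ℕ) (J : Finset ℕ) :
    MvPolynomial (Option (Fin (n - 1))) (ZMod 2) :=
  ∏ j ∈ J, xv n (2 * j)

theorem Derivation.map_map_eq_zero_of_X {σ : Type*} {R : Type*} [CommRing R] [CharP R 2]
    (d : Derivation R (MvPolynomial σ R) (MvPolynomial σ R))
    (hX : ∀ i, d (d (X i)) = 0) (p : MvPolynomial σ R) : d (d p) = 0 := by
  induction p using MvPolynomial.induction_on with
  | C a => rw [← algebraMap_eq, d.map_algebraMap, map_zero]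
  | add p q hp hq => rw [map_add, map_add, hp, hq, add_zero]
  | mul_X p i hp =>
    simp only [Derivation.leibniz, map_add, smul_eq_mul, hp, hX, mul_zero, zero_add]
    rw [mul_comm (d (X i)) (d p), CharTwo.add_self_eq_zero]

theorem Derivation.map_mul_of_map_eq_zero {R A : Type*} [CommRing R] [CommRing A] [Algebra R A]
    (d : Derivation R A A) {k : A} (hk : d k = 0) (a : A) : d (k * a) = k * d a := by
  rw [d.leibniz, hk, smul_zero, add_zero, smul_eq_mul]

theorem Derivation.map_mul_self_of_charTwo {R A : Type*} [CommRing R] [CommRing A] [CharP A 2]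
    [Algebra R A] (d : Derivation R A A) (a : A) : d (a * a) = 0 := by
  rw [d.leibniz, CharTwo.add_self_eq_zero]

theorem xv_add_two {n : ℕ} (m : Fin (n - 1)) : xv n (m + 2) = X (some m) := by
  have := m.2
  rw [xv, dif_pos ⟨by omega, by omega⟩]
  simp

/-- Every polynomial is a combination of the `θᵉ·c_J` with coefficients in `ker d`. -/
theorem mem_closure_ker_mul_generators (n : ℕ)
    (d : Derivation (ZMod 2) (MvPolynomial (Option (Fin (n - 1))) (ZMod 2))
      (MvPolynomial (Option (Fin (n - 1))) (ZMod 2)))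
    (htop : ∀ i : ℕ, 2 * i = n → d (xv n (2 * i)) = 0)
    (hodd : ∀ j : ℕ, Odd j → d (xv n j) = 0)
    (p : MvPolynomial (Option (Fin (n - 1))) (ZMod 2)) :
    p ∈ AddSubgroup.closure
        {q | ∃ k, d k = 0 ∧ ∃ e ≤ 1, ∃ J ⊆ Finset.Icc 1 ((n - 1) / 2),
            q = k * (θv n ^ e * cv n J)} := by
  induction p using MvPolynomial.induction_on with
  | C a =>
    refine AddSubgroup.subset_closure ⟨C a, ?_, 0, zero_le_one, ∅, Finset.empty_subset _, ?_⟩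
    · rw [← algebraMap_eq, d.map_algebraMap]
    · simp [cv]
  | add p q hp hq => exact add_mem hp hq
  | mul_X p i hp =>
    induction hp using AddSubgroup.closure_induction with
    | zero => rw [zero_mul]; exact zero_mem _
    | add x y _ _ hx hy => rw [add_mul]; exact add_mem hx hy
    | neg x _ hx => rw [neg_mul]; exact neg_mem hx
    | mem x hx =>
      obtain ⟨k, hk, e, he, J, hJ, rfl⟩ := hx
      refine AddSubgroup.subset_closure ?_
      have absorb (s : MvPolynomial (Option (Fin (n - 1))) (ZMod 2)) (hs : d s = 0) :
          d (k * s) = 0 := by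
        rw [d.map_mul_of_map_eq_zero hk, hs, mul_zero]
      cases i with
      | none =>
        obtain rfl | rfl : e = 0 ∨ e = 1 := by omega
        · exact ⟨k, hk, 1, le_rfl, J, hJ, by rw [θv]; ring⟩
        · exact ⟨k * (θv n * θv n), absorb _ (d.map_mul_self_of_charTwo _), 0, zero_le_one, J, hJ,
            by rw [θv]; ring⟩
      | some m =>
        have hm := m.2
        rw [← xv_add_two m]
        obtain ⟨j, hj⟩ | hj := Nat.even_or_odd (m + 2 : ℕ)
        · rw [← two_mul] at hj
          rw [hj]
          by_cases hjn : 2 * j = n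
          · exact ⟨k * xv n (2 * j), absorb _ (htop j hjn), e, he, J, hJ, by ring⟩
          · by_cases hjJ : j ∈ J
            · refine ⟨k * (xv n (2 * j) * xv n (2 * j)), absorb _ (d.map_mul_self_of_charTwo _),
                e, he, J.erase j, (Finset.erase_subset _ _).trans hJ, ?_⟩
              rw [cv, ← Finset.mul_prod_erase J (fun j => xv n (2 * j)) hjJ, cv]
              ring
            · refine ⟨k, hk, e, he, insert j J, Finset.insert_subset ?_ hJ, ?_⟩
              · rw [Finset.mem_Icc]; omega
              · rw [cv, cv, Finset.prod_insert hjJ]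
                ring
        · exact ⟨k * xv n (m + 2), absorb _ (hodd _ hj), e, he, J, hJ, by ring⟩

/-- The image of `d` (modelling `Sq²`) is contained in the `(ker d)`-submodule
of `R = 𝔽₂[θ, x₂, …, xₙ]` generated by the elements `d(θᵉ·c_J)` with
`e ∈ {0,1}` and `J ⊆ {1, …, ⌊(n−1)/2⌋}`, and the image of `D(p) = d(p) + θ·p`
(modelling `Sq²_Θ`) is contained in the `(ker d)`-submodule generated by the
elements `D(c_J)` (including `J = ∅`, with `D(c_∅) = θ`): for each `p`, `d p`
(resp. `D p`) lies in the additive subgroup generated by the products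
`k · d(θᵉ·c_J)` (resp. `k · D(c_J)`) with `k ∈ ker d`. Here `d` is the
𝔽₂-derivation with `d θ = θ²`, `d x_{2i} = x_{2i+1}` when `2i+1 ≤ n`,
`d x_{2i} = 0` when `2i = n`, and `d x_j = 0` for odd `j`. -/
theorem image_bockstein_generators (n : ℕ) (hn : 2 ≤ n)
    (d : Derivation (ZMod 2) (MvPolynomial (Option (Fin (n - 1))) (ZMod 2))
      (MvPolynomial (Option (Fin (n - 1))) (ZMod 2)))
    (hθ : d (θv n) = θv n ^ 2)
    (heven : ∀ i : ℕ, 1 ≤ i → 2 * i + 1 ≤ n → d (xv n (2 * i)) = xv n (2 * i + 1))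
    (htop : ∀ i : ℕ, 2 * i = n → d (xv n (2 * i)) = 0)
    (hodd : ∀ j : ℕ, Odd j → d (xv n j) = 0)
    (p : MvPolynomial (Option (Fin (n - 1))) (ZMod 2)) :
    d p ∈ AddSubgroup.closure
        {q | ∃ k, d k = 0 ∧ ∃ e ≤ 1, ∃ J ⊆ Finset.Icc 1 ((n - 1) / 2),
            q = k * d (θv n ^ e * cv n J)} ∧
      d p + θv n * p ∈ AddSubgroup.closure
        {q | ∃ k, d k = 0 ∧ ∃ J ⊆ Finset.Icc 1 ((n - 1) / 2),
            q = k * (d (cv n J) + θv n * cv n J)} := by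
  have hdd := d.map_map_eq_zero_of_X fun i => by
    cases i with
    | none =>
      rw [← θv, hθ, sq, d.map_mul_self_of_charTwo]
    | some m =>
      have hm := m.2
      rw [← xv_add_two m]
      obtain ⟨j, hj⟩ | hj := Nat.even_or_odd (m + 2 : ℕ)
      · rw [← two_mul] at hj
        rw [hj]
        by_cases hjn : 2 * j = n
        · rw [htop j hjn, map_zero]
        · rw [heven j (by omega) (by omega)]
          exact hodd _ (odd_two_mul_add_one j)
      · rw [hodd _ hj, map_zero]
  have hp := mem_closure_ker_mul_generators n d htop hodd p
  induction hp using AddSubgroup.closure_induction with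
  | zero => simp only [map_zero, mul_zero, add_zero]; exact ⟨zero_mem _, zero_mem _⟩
  | add x y _ _ hx hy =>
    rw [map_add, mul_add, add_add_add_comm]
    exact ⟨add_mem hx.1 hy.1, add_mem hx.2 hy.2⟩
  | neg x _ hx =>
    rw [map_neg, mul_neg, ← neg_add]
    exact ⟨neg_mem hx.1, neg_mem hx.2⟩
  | mem x hx =>
    obtain ⟨k, hk, e, he, J, hJ, rfl⟩ := hx
    refine ⟨AddSubgroup.subset_closure ⟨k, hk, e, he, J, hJ, d.map_mul_of_map_eq_zero hk _⟩,
      AddSubgroup.subset_closure ?_⟩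
    rw [d.map_mul_of_map_eq_zero hk]
    obtain rfl | rfl : e = 0 ∨ e = 1 := by omega
    · exact ⟨k, hk, J, hJ, by ring_nf⟩
    · refine ⟨k * d (cv n J), by rw [d.map_mul_of_map_eq_zero hk, hdd, mul_zero], ∅,
        Finset.empty_subset _, ?_⟩
      have h2 := CharTwo.add_self_eq_zero (θv n ^ 2 * cv n J)
      simp only [cv, Finset.prod_empty, d.map_one_eq_zero, pow_one, d.leibniz, hθ,
        smul_eq_mul] at h2 ⊢
      linear_combination k * h2
end
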